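/- The graded module 𝒦*_{(α,β)}(C,B) with 𝒦ⁿ_{(α,β)}(C,B) = C^⊗n ⊗ B, product (c¹⊗⋯⊗cⁿ⊗b)(cⁿ⁺¹⊗⋯⊗cⁿ⁺ᵐ⊗b') = c¹⊗⋯⊗cⁿ ⊗ α(b₍₁₎)cⁿ⁺¹β(b₍₂ₘ₊₁₎) ⊗ ⋯ ⊗ α(b₍ₘ₎)cⁿ⁺ᵐβ(b₍ₘ₊₂₎) ⊗ b₍ₘ₊₁₎b', and differential d(c¹⊗⋯⊗cⁿ⊗b) = −(𝕀⊗c¹⊗⋯⊗cⁿ⊗b) + Σⱼ₌₁ⁿ(−1)^{j−1}(c¹⊗⋯⊗cʲ₍₁₎⊗cʲ₍₂₎⊗⋯⊗b) + (−1)ⁿ(c¹⊗⋯⊗cⁿ⊗α(b₍₁₎)𝕀β(b₍₃₎)⊗b₍₂₎) is a differential graded k-algebra. -/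

import Mathlib

/- STATEMENT 17: The graded module 𝒦*_{(α,β)}(C,B) with 𝒦ⁿ = C^⊗n ⊗ B, the product
(c¹⊗⋯⊗cⁿ⊗b)(cⁿ⁺¹⊗⋯⊗cⁿ⁺ᵐ⊗b') = c¹⊗⋯⊗cⁿ⊗α(b₍₁₎)cⁿ⁺¹β(b₍₂ₘ₊₁₎)⊗⋯⊗b₍ₘ₊₁₎b' and the
differential d(c¹⊗⋯⊗cⁿ⊗b) = −(𝕀⊗⋯⊗b) + Σ(−1)^{j−1}(⋯cʲ₍₁₎⊗cʲ₍₂₎⋯)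
+ (−1)ⁿ(⋯⊗α(b₍₁₎)𝕀β(b₍₃₎)⊗b₍₂₎) is a differential graded k-algebra. -/

open TensorProduct

noncomputable section

variable (k : Type) [Field k] (B : Type) [Ring B] [Bialgebra k B]
variable (C : Type) [AddCommGroup C] [Module k C]
variable (DeltaC : C →ₗ[k] C ⊗[k] C)
variable (l : B →ₗ[k] C →ₗ[k] C) (r : B →ₗ[k] C →ₗ[k] C)
variable (alpha : B →ₗ[k] B) (beta : B →ₗ[k] B) (I : C)

def Delta2B : B →ₗ[k] (B ⊗[k] B) ⊗[k] B :=
  (TensorProduct.map Coalgebra.comul LinearMap.id) ∘ₗ Coalgebra.comul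

variable {A A' A'' : Type} [AddCommGroup A] [AddCommGroup A'] [AddCommGroup A'']
  [Module k A] [Module k A'] [Module k A'']

def sw3 : (A ⊗[k] A') ⊗[k] A'' →ₗ[k] (A ⊗[k] A'') ⊗[k] A' :=
  (TensorProduct.assoc k A A'' A').symm.toLinearMap
    ∘ₗ (TensorProduct.map LinearMap.id (TensorProduct.comm k A' A'').toLinearMap)
    ∘ₗ (TensorProduct.assoc k A A' A'').toLinearMap

/-- `(a ⊗ b) ⊗ c ↦ α(a) c β(b)`, the two-sided action on one `C`-leg. -/
def legB : (B ⊗[k] B) ⊗[k] C →ₗ[k] C :=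
  TensorProduct.lift (TensorProduct.lift (LinearMap.mk₂ k
    (fun (a b : B) => (l (alpha a)) ∘ₗ (r (beta b)))
    (fun a a' b => by simp [map_add, LinearMap.add_comp])
    (fun c a b => by simp [map_smul, LinearMap.smul_comp])
    (fun a b b' => by simp [map_add, LinearMap.comp_add])
    (fun c a b => by simp [map_smul, LinearMap.comp_smul])))

/-- `𝒦ⁿ_{(α,β)}(C,B) = C^⊗n ⊗ B`, nested as `C ⊗ (C ⊗ (⋯ ⊗ B))`. -/
def KB : ℕ → ModuleCat k := fun n =>
  Nat.rec (ModuleCat.of k B) (fun _ ih => ModuleCat.of k (C ⊗[k] ih)) n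

/-- The left action of `B` on `𝒦ⁿ_{(α,β)}(C,B)`:
`b·(c¹⊗⋯⊗cⁿ⊗b') = α(b₍₁₎)c¹β(b₍₂ₙ₊₁₎)⊗⋯⊗α(b₍ₙ₎)cⁿβ(b₍ₙ₊₂₎)⊗b₍ₙ₊₁₎b'`. -/
def lactB : ∀ n : ℕ, B ⊗[k] (KB k B C n) →ₗ[k] (KB k B C n)
  | 0 => LinearMap.mul' k B
  | n + 1 =>
    (TensorProduct.map (legB k B C l r alpha beta) (lactB n))
      ∘ₗ (TensorProduct.tensorTensorTensorComm k (B ⊗[k] B) B C (KB k B C n)).toLinearMap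
      ∘ₗ (TensorProduct.map (sw3 k ∘ₗ Delta2B k B) LinearMap.id)

/-- The product of `𝒦*_{(α,β)}(C,B)`. -/
def muB : ∀ (n m : ℕ), (KB k B C n) ⊗[k] (KB k B C m) →ₗ[k] KB k B C (m + n)
  | 0, m => lactB k B C l r alpha beta m
  | n + 1, m =>
    (TensorProduct.map LinearMap.id (muB n m))
      ∘ₗ (TensorProduct.assoc k C (KB k B C n) (KB k B C m)).toLinearMap

/-- `b₁ ⊗ b₃ ↦ α(b₁) 𝕀 β(b₃)`. -/
def xiB : B ⊗[k] B →ₗ[k] C :=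
  TensorProduct.lift (LinearMap.mk₂ k
    (fun (a b : B) => l (alpha a) (r (beta b) I))
    (fun a a' b => by simp [map_add, LinearMap.add_apply])
    (fun c a b => by simp [map_smul, LinearMap.smul_apply])
    (fun a b b' => by simp [map_add, LinearMap.add_apply])
    (fun c a b => by simp [map_smul, LinearMap.smul_apply]))

/-- `ρ_B(b) = α(b₍₁₎)𝕀β(b₍₃₎) ⊗ b₍₂₎`. -/
def rhoB : B →ₗ[k] C ⊗[k] B :=
  (TensorProduct.map (xiB k B C l r alpha beta I) LinearMap.id)
    ∘ₗ sw3 k ∘ₗ Delta2B k B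

def unrollB (n : ℕ) : (KB k B C (n + 1)) →ₗ[k] C ⊗[k] (KB k B C n) := LinearMap.id

/-- The differential of `𝒦*_{(α,β)}(C,B)`. -/
def dB : ∀ n : ℕ, (KB k B C n) →ₗ[k] (KB k B C (n + 1))
  | 0 => rhoB k B C l r alpha beta I - (TensorProduct.mk k C B I)
  | n + 1 =>
    ((TensorProduct.assoc k C C (KB k B C n)).toLinearMap
        ∘ₗ (TensorProduct.map DeltaC LinearMap.id))
      - ((TensorProduct.mk k C (C ⊗[k] (KB k B C n))) I)
      - (TensorProduct.map (LinearMap.id : C →ₗ[k] C)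
          ((TensorProduct.mk k C (KB k B C n)) I))
      - (TensorProduct.map (LinearMap.id : C →ₗ[k] C)
          (unrollB k B C n ∘ₗ dB n))

def dcastB {a b : ℕ} (h : a = b) : (KB k B C a) →ₗ[k] (KB k B C b) := by
  subst h; exact LinearMap.id


section Helpers

variable {k B C DeltaC l r alpha beta I}

lemma sw3_tmul (a : A) (a' : A') (a'' : A'') :
    sw3 k ((a ⊗ₜ[k] a') ⊗ₜ[k] a'') = (a ⊗ₜ[k] a'') ⊗ₜ[k] a' := rfl

/-- Iterated comultiplication of the middle leg agrees with comultiplication of the outer legs. -/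
lemma assoc_comp_map_Delta2B :
    (TensorProduct.assoc k ((B ⊗[k] B) ⊗[k] B) B B).toLinearMap ∘ₗ
        (TensorProduct.map (TensorProduct.map
            (TensorProduct.assoc k B B B).symm.toLinearMap LinearMap.id ∘ₗ
          (TensorProduct.assoc k B (B ⊗[k] B) B).symm.toLinearMap) LinearMap.id) ∘ₗ
        (TensorProduct.map (TensorProduct.map LinearMap.id (Delta2B k B)) LinearMap.id) ∘ₗ
        Delta2B k B =
      (TensorProduct.map (TensorProduct.map Coalgebra.comul LinearMap.id) Coalgebra.comul) ∘ₗ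
        Delta2B k B := by
  unfold Delta2B
  simp only [coassoc_simps]

lemma sw3_comp_map {M M' M'' : Type} [AddCommGroup M] [AddCommGroup M'] [AddCommGroup M'']
    [Module k M] [Module k M'] [Module k M'']
    (f : A →ₗ[k] M) (g : A' →ₗ[k] M') (h : A'' →ₗ[k] M'') :
    sw3 k ∘ₗ TensorProduct.map (TensorProduct.map f g) h =
      TensorProduct.map (TensorProduct.map f h) g ∘ₗ sw3 k := by
  ext
  rfl

lemma map_sw3_comp_sw3 :
    (TensorProduct.map (LinearMap.id : B ⊗[k] B →ₗ[k] B ⊗[k] B)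
        (sw3 k : (B ⊗[k] B) ⊗[k] B →ₗ[k] _)) ∘ₗ sw3 k =
      (TensorProduct.assoc k (B ⊗[k] B) (B ⊗[k] B) B).toLinearMap ∘ₗ
        (TensorProduct.map ((TensorProduct.tensorTensorTensorComm k B B B B).toLinearMap ∘ₗ
          TensorProduct.map LinearMap.id (TensorProduct.comm k B B).toLinearMap) LinearMap.id) ∘ₗ
        sw3 k ∘ₗ (TensorProduct.assoc k ((B ⊗[k] B) ⊗[k] B) B B).toLinearMap ∘ₗ
        (TensorProduct.map (TensorProduct.map
            (TensorProduct.assoc k B B B).symm.toLinearMap LinearMap.id ∘ₗ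
          (TensorProduct.assoc k B (B ⊗[k] B) B).symm.toLinearMap) LinearMap.id) := by
  ext
  rfl

/-- Coassociativity of `b ↦ (b₍₁₎ ⊗ b₍₃₎) ⊗ b₍₂₎`, with values in `(B ⊗ B^{cop}) ⊗ B`. -/
lemma map_sw3_comp_Delta2B :
    (TensorProduct.map LinearMap.id (sw3 k ∘ₗ Delta2B k B)) ∘ₗ sw3 k ∘ₗ Delta2B k B =
      (TensorProduct.assoc k (B ⊗[k] B) (B ⊗[k] B) B).toLinearMap ∘ₗ
        (TensorProduct.map ((TensorProduct.tensorTensorTensorComm k B B B B).toLinearMap ∘ₗ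
          TensorProduct.map LinearMap.id (TensorProduct.comm k B B).toLinearMap) LinearMap.id) ∘ₗ
        (TensorProduct.map (TensorProduct.map Coalgebra.comul Coalgebra.comul) LinearMap.id) ∘ₗ
        sw3 k ∘ₗ Delta2B k B := by
  have hL : (TensorProduct.map LinearMap.id (sw3 k ∘ₗ Delta2B k B)) ∘ₗ sw3 k ∘ₗ Delta2B k B =
      ((TensorProduct.map (LinearMap.id : B ⊗[k] B →ₗ[k] B ⊗[k] B)
        (sw3 k : (B ⊗[k] B) ⊗[k] B →ₗ[k] _)) ∘ₗ sw3 k) ∘ₗ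
        (TensorProduct.map (TensorProduct.map LinearMap.id (Delta2B k B)) LinearMap.id) ∘ₗ
        Delta2B k B := by
    rw [LinearMap.comp_assoc, ← LinearMap.comp_assoc (Delta2B k B) _ (sw3 k), sw3_comp_map]
    simp only [LinearMap.comp_assoc, TensorProduct.map_id, LinearMap.id_comp,
      CoassocSimps.TensorProduct.map_comp_assoc]
  rw [hL, map_sw3_comp_sw3]
  simp only [LinearMap.comp_assoc]
  rw [assoc_comp_map_Delta2B, ← LinearMap.comp_assoc (Delta2B k B) _ (sw3 k), sw3_comp_map,
    LinearMap.comp_assoc]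

lemma sw3_mul (u v : (B ⊗[k] B) ⊗[k] B) : sw3 k (u * v) = sw3 k u * sw3 k v := by
  induction u with
  | zero => simp
  | add u u' h h' => simp [add_mul, h, h']
  | tmul w s =>
    induction w with
    | zero => simp
    | add w w' h h' => simp only [add_tmul, add_mul, map_add, h, h']
    | tmul p q =>
      induction v with
      | zero => simp
      | add v v' h h' => simp only [mul_add, map_add, h, h']
      | tmul w' s' =>
        induction w' with
        | zero => simp
        | add w w' h h' => simp only [add_tmul, mul_add, map_add, h, h']
        | tmul p' q' => simp [sw3]

lemma Delta2B_mul (a b : B) : Delta2B k B (a * b) = Delta2B k B a * Delta2B k B b := by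
  simp only [Delta2B, LinearMap.comp_apply, Bialgebra.comul_mul]
  exact map_mul (Algebra.TensorProduct.map (Bialgebra.comulAlgHom k B) (AlgHom.id k B)) _ _

lemma Delta2B_one : Delta2B k B 1 = 1 := by
  simp [Delta2B, Algebra.TensorProduct.one_def]


lemma legB_tmul (p q : B) (c : C) :
    legB k B C l r alpha beta ((p ⊗ₜ[k] q) ⊗ₜ[k] c) = l (alpha p) (r (beta q) c) := rfl

lemma xiB_tmul (p q : B) :
    xiB k B C l r alpha beta I (p ⊗ₜ[k] q) = legB k B C l r alpha beta ((p ⊗ₜ[k] q) ⊗ₜ[k] I) := rfl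

variable (l r alpha beta) in
/-- `((p ⊗ q) ⊗ s) ⊗ (c ⊗ x) ↦ α(p) c β(q) ⊗ s·x`. -/
def legAct {X : Type} [AddCommGroup X] [Module k X] (f : B ⊗[k] X →ₗ[k] X) :
    ((B ⊗[k] B) ⊗[k] B) ⊗[k] (C ⊗[k] X) →ₗ[k] C ⊗[k] X :=
  (TensorProduct.map (legB k B C l r alpha beta) f) ∘ₗ
    (TensorProduct.tensorTensorTensorComm k (B ⊗[k] B) B C X).toLinearMap

variable (l r alpha beta) in
/-- The action of `B` on `C ⊗ X` induced by an action on `X`. -/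
def actTensor {X : Type} [AddCommGroup X] [Module k X] (f : B ⊗[k] X →ₗ[k] X) :
    B ⊗[k] (C ⊗[k] X) →ₗ[k] C ⊗[k] X :=
  legAct l r alpha beta f ∘ₗ (TensorProduct.map (sw3 k ∘ₗ Delta2B k B) LinearMap.id)

variable (DeltaC I) in
/-- The differential on `C ⊗ X` induced by a map `X → C ⊗ X`. -/
def dTensor {X : Type} [AddCommGroup X] [Module k X] (d : X →ₗ[k] C ⊗[k] X) :
    C ⊗[k] X →ₗ[k] C ⊗[k] (C ⊗[k] X) :=
  ((TensorProduct.assoc k C C X).toLinearMap ∘ₗ (TensorProduct.map DeltaC LinearMap.id))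
    - ((TensorProduct.mk k C (C ⊗[k] X)) I)
    - (TensorProduct.map (LinearMap.id : C →ₗ[k] C) ((TensorProduct.mk k C X) I))
    - (TensorProduct.map (LinearMap.id : C →ₗ[k] C) d)

section Abstract

variable {X : Type} [AddCommGroup X] [Module k X]

lemma legAct_tmul (f : B ⊗[k] X →ₗ[k] X) (w : B ⊗[k] B) (s : B) (c : C) (x : X) :
    legAct l r alpha beta f ((w ⊗ₜ[k] s) ⊗ₜ[k] (c ⊗ₜ[k] x)) =
      legB k B C l r alpha beta (w ⊗ₜ[k] c) ⊗ₜ[k] f (s ⊗ₜ[k] x) := rfl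

lemma actTensor_tmul (f : B ⊗[k] X →ₗ[k] X) (b : B) (y : C ⊗[k] X) :
    actTensor l r alpha beta f (b ⊗ₜ[k] y) =
      legAct l r alpha beta f (sw3 k (Delta2B k B b) ⊗ₜ[k] y) := rfl

lemma dTensor_tmul (d : X →ₗ[k] C ⊗[k] X) (c : C) (x : X) :
    dTensor DeltaC I d (c ⊗ₜ[k] x) =
      TensorProduct.assoc k C C X (DeltaC c ⊗ₜ[k] x) - I ⊗ₜ[k] (c ⊗ₜ[k] x)
        - c ⊗ₜ[k] (I ⊗ₜ[k] x) - c ⊗ₜ[k] d x := rfl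

lemma legAct_mul
    (hlm : ∀ a b : B, l (a * b) = l a ∘ₗ l b) (hrm : ∀ a b : B, r (a * b) = r b ∘ₗ r a)
    (hlr : ∀ a b : B, l a ∘ₗ r b = r b ∘ₗ l a)
    (ham : ∀ a b : B, alpha (a * b) = alpha a * alpha b)
    (hbm : ∀ a b : B, beta (a * b) = beta b * beta a)
    (f : B ⊗[k] X →ₗ[k] X)
    (hf : ∀ (a b : B) (x : X), f ((a * b) ⊗ₜ[k] x) = f (a ⊗ₜ[k] f (b ⊗ₜ[k] x)))
    (u v : (B ⊗[k] B) ⊗[k] B) (y : C ⊗[k] X) :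
    legAct l r alpha beta f ((u * v) ⊗ₜ[k] y) =
      legAct l r alpha beta f (u ⊗ₜ[k] legAct l r alpha beta f (v ⊗ₜ[k] y)) := by
  induction y with
  | zero => simp
  | add y y' h h' => simp only [tmul_add, map_add, h, h']
  | tmul c x =>
  induction u with
  | zero => simp
  | add u u' h h' => simp only [add_mul, add_tmul, map_add, h, h']
  | tmul w s =>
  induction w with
  | zero => simp
  | add w w' h h' => simp only [add_tmul, add_mul, map_add, h, h']
  | tmul p q =>
  induction v with
  | zero => simp
  | add v v' h h' => simp only [mul_add, add_tmul, tmul_add, map_add, h, h']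
  | tmul w' s' =>
  induction w' with
  | zero => simp
  | add w w' h h' => simp only [add_tmul, mul_add, tmul_add, map_add, h, h']
  | tmul p' q' =>
    have h : ∀ (a b : B) (c : C), l a (r b c) = r b (l a c) :=
      fun a b c => LinearMap.congr_fun (hlr a b) c
    simp only [Algebra.TensorProduct.tmul_mul_tmul, legAct_tmul, legB_tmul, ham, hbm, hlm, hrm,
      LinearMap.comp_apply, hf, h]

lemma actTensor_mul
    (hlm : ∀ a b : B, l (a * b) = l a ∘ₗ l b) (hrm : ∀ a b : B, r (a * b) = r b ∘ₗ r a)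
    (hlr : ∀ a b : B, l a ∘ₗ r b = r b ∘ₗ l a)
    (ham : ∀ a b : B, alpha (a * b) = alpha a * alpha b)
    (hbm : ∀ a b : B, beta (a * b) = beta b * beta a)
    (f : B ⊗[k] X →ₗ[k] X)
    (hf : ∀ (a b : B) (x : X), f ((a * b) ⊗ₜ[k] x) = f (a ⊗ₜ[k] f (b ⊗ₜ[k] x)))
    (a b : B) (y : C ⊗[k] X) :
    actTensor l r alpha beta f ((a * b) ⊗ₜ[k] y) =
      actTensor l r alpha beta f (a ⊗ₜ[k] actTensor l r alpha beta f (b ⊗ₜ[k] y)) := by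
  simp only [actTensor_tmul, Delta2B_mul, sw3_mul]
  exact legAct_mul hlm hrm hlr ham hbm f hf _ _ y

variable (l r alpha beta) in
/-- `(p₁ ⊗ p₂) ⊗ (q₁ ⊗ q₂)` acts on `c ⊗ c'` by `α(p₁) c β(q₂) ⊗ α(p₂) c' β(q₁)`. -/
def legB₂ : ((B ⊗[k] B) ⊗[k] (B ⊗[k] B)) ⊗[k] (C ⊗[k] C) →ₗ[k] C ⊗[k] C :=
  (TensorProduct.map (legB k B C l r alpha beta) (legB k B C l r alpha beta)) ∘ₗ
    (TensorProduct.tensorTensorTensorComm k (B ⊗[k] B) (B ⊗[k] B) C C).toLinearMap ∘ₗ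
    (TensorProduct.map ((TensorProduct.tensorTensorTensorComm k B B B B).toLinearMap ∘ₗ
      TensorProduct.map LinearMap.id (TensorProduct.comm k B B).toLinearMap) LinearMap.id)

/-- `Δ_C(α(p) c β(q)) = α(p₍₁₎) c₍₁₎ β(q₍₂₎) ⊗ α(p₍₂₎) c₍₂₎ β(q₍₁₎)`. -/
lemma DeltaC_legB
    (hbimL : DeltaC ∘ₗ TensorProduct.lift l =
        (TensorProduct.map (TensorProduct.lift l) (TensorProduct.lift l))
          ∘ₗ (TensorProduct.tensorTensorTensorComm k B B C C).toLinearMap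
          ∘ₗ (TensorProduct.map Coalgebra.comul DeltaC))
    (hbimR : DeltaC ∘ₗ TensorProduct.lift r =
        (TensorProduct.map (TensorProduct.lift r) (TensorProduct.lift r))
          ∘ₗ (TensorProduct.tensorTensorTensorComm k B B C C).toLinearMap
          ∘ₗ (TensorProduct.map Coalgebra.comul DeltaC))
    (hac : Coalgebra.comul ∘ₗ alpha = (TensorProduct.map alpha alpha) ∘ₗ Coalgebra.comul)
    (hbc : Coalgebra.comul ∘ₗ beta =
        (TensorProduct.comm k B B).toLinearMap
          ∘ₗ (TensorProduct.map beta beta) ∘ₗ Coalgebra.comul)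
    (p q : B) (c : C) :
    DeltaC (legB k B C l r alpha beta ((p ⊗ₜ[k] q) ⊗ₜ[k] c)) =
      legB₂ l r alpha beta
        ((Coalgebra.comul p ⊗ₜ[k] Coalgebra.comul q) ⊗ₜ[k] DeltaC c) := by
  have hL (b : B) (c : C) : DeltaC (l b c) = TensorProduct.map (lift l) (lift l)
      (TensorProduct.tensorTensorTensorComm k B B C C (Coalgebra.comul b ⊗ₜ[k] DeltaC c)) :=
    LinearMap.congr_fun hbimL (b ⊗ₜ[k] c)
  have hR (b : B) (c : C) : DeltaC (r b c) = TensorProduct.map (lift r) (lift r)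
      (TensorProduct.tensorTensorTensorComm k B B C C (Coalgebra.comul b ⊗ₜ[k] DeltaC c)) :=
    LinearMap.congr_fun hbimR (b ⊗ₜ[k] c)
  have hα : Coalgebra.comul (alpha p) = TensorProduct.map alpha alpha (Coalgebra.comul p) :=
    LinearMap.congr_fun hac p
  have hβ : Coalgebra.comul (beta q) = TensorProduct.comm k B B
      (TensorProduct.map beta beta (Coalgebra.comul q)) := LinearMap.congr_fun hbc q
  rw [legB_tmul, hL, hR, hα, hβ]
  generalize (Coalgebra.comul p : B ⊗[k] B) = P
  generalize (Coalgebra.comul q : B ⊗[k] B) = Q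
  generalize DeltaC c = D
  induction P with
  | zero => simp
  | add P P' h h' => simp only [add_tmul, map_add, h, h']
  | tmul p p' =>
  induction Q with
  | zero => simp
  | add Q Q' h h' => simp only [add_tmul, tmul_add, map_add, h, h']
  | tmul q q' =>
  induction D with
  | zero => simp
  | add D D' h h' => simp only [tmul_add, map_add, h, h']
  | tmul c c' => rfl

lemma assoc_legB₂_tmul (f : B ⊗[k] X →ₗ[k] X) (Q : (B ⊗[k] B) ⊗[k] (B ⊗[k] B)) (s : B)
    (D : C ⊗[k] C) (x : X) :
    TensorProduct.assoc k C C X (legB₂ l r alpha beta (Q ⊗ₜ[k] D) ⊗ₜ[k] f (s ⊗ₜ[k] x)) =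
      TensorProduct.map (legB k B C l r alpha beta) (legAct l r alpha beta f)
        (TensorProduct.tensorTensorTensorComm k (B ⊗[k] B) ((B ⊗[k] B) ⊗[k] B) C (C ⊗[k] X)
          (TensorProduct.assoc k (B ⊗[k] B) (B ⊗[k] B) B
            (TensorProduct.map ((TensorProduct.tensorTensorTensorComm k B B B B).toLinearMap ∘ₗ
              TensorProduct.map LinearMap.id (TensorProduct.comm k B B).toLinearMap)
              LinearMap.id (Q ⊗ₜ[k] s)) ⊗ₜ[k]
            TensorProduct.assoc k C C X (D ⊗ₜ[k] x))) := by
  induction D with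
  | zero => simp
  | add D D' h h' => simp only [add_tmul, tmul_add, map_add, h, h']
  | tmul c c' =>
  induction Q with
  | zero => simp
  | add Q Q' h h' => simp only [add_tmul, map_add, h, h']
  | tmul P Q =>
  induction P with
  | zero => simp
  | add P P' h h' => simp only [add_tmul, map_add, h, h']
  | tmul p p' =>
  induction Q with
  | zero => simp
  | add Q Q' h h' => simp only [add_tmul, tmul_add, map_add, h, h']
  | tmul q q' => rfl

lemma legAct_actTensor (f : B ⊗[k] X →ₗ[k] X) (u : (B ⊗[k] B) ⊗[k] B)
    (y : C ⊗[k] (C ⊗[k] X)) :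
    legAct l r alpha beta (actTensor l r alpha beta f) (u ⊗ₜ[k] y) =
      TensorProduct.map (legB k B C l r alpha beta) (legAct l r alpha beta f)
        (TensorProduct.tensorTensorTensorComm k (B ⊗[k] B) ((B ⊗[k] B) ⊗[k] B) C (C ⊗[k] X)
          (TensorProduct.map LinearMap.id (sw3 k ∘ₗ Delta2B k B) u ⊗ₜ[k] y)) := by
  induction y with
  | zero => simp
  | add y y' h h' => simp only [tmul_add, map_add, h, h']
  | tmul c z =>
  induction u with
  | zero => simp
  | add u u' h h' => simp only [add_tmul, map_add, h, h']
  | tmul w s => rfl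

/-- Comultiplying the first `C`-leg commutes with the action of `B`. -/
lemma assoc_map_DeltaC_actTensor
    (hbimL : DeltaC ∘ₗ TensorProduct.lift l =
        (TensorProduct.map (TensorProduct.lift l) (TensorProduct.lift l))
          ∘ₗ (TensorProduct.tensorTensorTensorComm k B B C C).toLinearMap
          ∘ₗ (TensorProduct.map Coalgebra.comul DeltaC))
    (hbimR : DeltaC ∘ₗ TensorProduct.lift r =
        (TensorProduct.map (TensorProduct.lift r) (TensorProduct.lift r))
          ∘ₗ (TensorProduct.tensorTensorTensorComm k B B C C).toLinearMap
          ∘ₗ (TensorProduct.map Coalgebra.comul DeltaC))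
    (hac : Coalgebra.comul ∘ₗ alpha = (TensorProduct.map alpha alpha) ∘ₗ Coalgebra.comul)
    (hbc : Coalgebra.comul ∘ₗ beta =
        (TensorProduct.comm k B B).toLinearMap
          ∘ₗ (TensorProduct.map beta beta) ∘ₗ Coalgebra.comul)
    (f : B ⊗[k] X →ₗ[k] X) (b : B) (c : C) (x : X) :
    TensorProduct.assoc k C C X (TensorProduct.map DeltaC LinearMap.id
        (actTensor l r alpha beta f (b ⊗ₜ[k] (c ⊗ₜ[k] x)))) =
      actTensor l r alpha beta (actTensor l r alpha beta f)
        (b ⊗ₜ[k] TensorProduct.assoc k C C X (DeltaC c ⊗ₜ[k] x)) := by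
  have key := LinearMap.congr_fun (map_sw3_comp_Delta2B (k := k) (B := B)) b
  simp only [LinearMap.comp_apply] at key
  rw [actTensor_tmul, actTensor_tmul, legAct_actTensor, key]
  generalize sw3 k (Delta2B k B b) = u
  induction u with
  | zero => simp
  | add u u' h h' => simp only [add_tmul, map_add, h, h']
  | tmul w s =>
  induction w with
  | zero => simp
  | add w w' h h' => simp only [add_tmul, map_add, h, h']
  | tmul p q =>
    rw [legAct_tmul, TensorProduct.map_tmul, DeltaC_legB hbimL hbimR hac hbc]
    exact assoc_legB₂_tmul f _ s _ x

lemma dTensor_apply (d : X →ₗ[k] C ⊗[k] X) (y : C ⊗[k] X) :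
    dTensor DeltaC I d y =
      TensorProduct.assoc k C C X (TensorProduct.map DeltaC LinearMap.id y) - I ⊗ₜ[k] y
        - TensorProduct.map LinearMap.id (TensorProduct.mk k C X I) y
        - TensorProduct.map LinearMap.id d y := rfl

lemma map_legAct (f : B ⊗[k] X →ₗ[k] X) (d : X →ₗ[k] C ⊗[k] X)
    (hd : ∀ (b : B) (x : X), d (f (b ⊗ₜ[k] x)) =
      actTensor l r alpha beta f (b ⊗ₜ[k] (I ⊗ₜ[k] x)) - I ⊗ₜ[k] f (b ⊗ₜ[k] x)
        + actTensor l r alpha beta f (b ⊗ₜ[k] d x))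
    (u : (B ⊗[k] B) ⊗[k] B) (c : C) (x : X) :
    TensorProduct.map LinearMap.id (TensorProduct.mk k C X I)
        (legAct l r alpha beta f (u ⊗ₜ[k] (c ⊗ₜ[k] x))) +
      TensorProduct.map LinearMap.id d (legAct l r alpha beta f (u ⊗ₜ[k] (c ⊗ₜ[k] x))) =
    legAct l r alpha beta (actTensor l r alpha beta f) (u ⊗ₜ[k] (c ⊗ₜ[k] (I ⊗ₜ[k] x))) +
      legAct l r alpha beta (actTensor l r alpha beta f) (u ⊗ₜ[k] (c ⊗ₜ[k] d x)) := by
  induction u with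
  | zero => simp
  | add u u' h h' =>
    simp only [add_tmul, map_add]
    rw [add_add_add_comm, h, h', add_add_add_comm]
  | tmul w s =>
    simp only [legAct_tmul, TensorProduct.map_tmul, LinearMap.id_apply, TensorProduct.mk_apply,
      ← tmul_add, hd]
    congr 1
    abel

/-- The Leibniz rule for the action of `B` passes from `X` to `C ⊗ X`. -/
lemma dTensor_actTensor
    (hbimL : DeltaC ∘ₗ TensorProduct.lift l =
        (TensorProduct.map (TensorProduct.lift l) (TensorProduct.lift l))
          ∘ₗ (TensorProduct.tensorTensorTensorComm k B B C C).toLinearMap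
          ∘ₗ (TensorProduct.map Coalgebra.comul DeltaC))
    (hbimR : DeltaC ∘ₗ TensorProduct.lift r =
        (TensorProduct.map (TensorProduct.lift r) (TensorProduct.lift r))
          ∘ₗ (TensorProduct.tensorTensorTensorComm k B B C C).toLinearMap
          ∘ₗ (TensorProduct.map Coalgebra.comul DeltaC))
    (hac : Coalgebra.comul ∘ₗ alpha = (TensorProduct.map alpha alpha) ∘ₗ Coalgebra.comul)
    (hbc : Coalgebra.comul ∘ₗ beta =
        (TensorProduct.comm k B B).toLinearMap
          ∘ₗ (TensorProduct.map beta beta) ∘ₗ Coalgebra.comul)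
    (f : B ⊗[k] X →ₗ[k] X) (d : X →ₗ[k] C ⊗[k] X)
    (hd : ∀ (b : B) (x : X), d (f (b ⊗ₜ[k] x)) =
      actTensor l r alpha beta f (b ⊗ₜ[k] (I ⊗ₜ[k] x)) - I ⊗ₜ[k] f (b ⊗ₜ[k] x)
        + actTensor l r alpha beta f (b ⊗ₜ[k] d x))
    (b : B) (y : C ⊗[k] X) :
    dTensor DeltaC I d (actTensor l r alpha beta f (b ⊗ₜ[k] y)) =
      actTensor l r alpha beta (actTensor l r alpha beta f) (b ⊗ₜ[k] (I ⊗ₜ[k] y))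
        - I ⊗ₜ[k] actTensor l r alpha beta f (b ⊗ₜ[k] y)
        + actTensor l r alpha beta (actTensor l r alpha beta f)
            (b ⊗ₜ[k] dTensor DeltaC I d y) := by
  induction y with
  | zero => simp
  | add y y' h h' =>
    simp only [tmul_add, map_add, h, h']
    abel
  | tmul c x =>
    have h := map_legAct f d hd (sw3 k (Delta2B k B b)) c x
    rw [dTensor_apply, assoc_map_DeltaC_actTensor hbimL hbimR hac hbc, dTensor_tmul, sub_sub,
      actTensor_tmul f, h]
    simp only [tmul_sub, map_sub, actTensor_tmul (actTensor l r alpha beta f)]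
    abel

/-- `d² = 0` passes from `X` to `C ⊗ X`. -/
lemma dTensor_dTensor
    (hDc : (TensorProduct.assoc k C C C).toLinearMap ∘ₗ
        (TensorProduct.map DeltaC LinearMap.id) ∘ₗ DeltaC =
        (TensorProduct.map LinearMap.id DeltaC) ∘ₗ DeltaC)
    (hI : DeltaC I = I ⊗ₜ[k] I)
    (d : X →ₗ[k] C ⊗[k] X) (hd : ∀ x, dTensor DeltaC I d (d x) = 0) (y : C ⊗[k] X) :
    dTensor DeltaC I (dTensor DeltaC I d) (dTensor DeltaC I d y) = 0 := by
  induction y with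
  | zero => simp
  | add y y' h h' => simp only [map_add, h, h', add_zero]
  | tmul c x =>
    have coassoc : TensorProduct.assoc k C C (C ⊗[k] X) (TensorProduct.map DeltaC LinearMap.id
          (TensorProduct.assoc k C C X (DeltaC c ⊗ₜ[k] x))) =
        TensorProduct.map LinearMap.id ((TensorProduct.assoc k C C X).toLinearMap ∘ₗ
          TensorProduct.map DeltaC LinearMap.id)
          (TensorProduct.assoc k C C X (DeltaC c ⊗ₜ[k] x)) := by
      have h1 (D : C ⊗[k] C) : TensorProduct.assoc k C C (C ⊗[k] X)
          (TensorProduct.map DeltaC LinearMap.id (TensorProduct.assoc k C C X (D ⊗ₜ[k] x))) =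
          TensorProduct.map LinearMap.id (TensorProduct.assoc k C C X).toLinearMap
            (TensorProduct.assoc k C (C ⊗[k] C) X (TensorProduct.assoc k C C C
              (TensorProduct.map DeltaC LinearMap.id D) ⊗ₜ[k] x)) := by
        induction D with
        | zero => simp
        | add D D' h h' => simp only [add_tmul, map_add, h, h']
        | tmul p q =>
          simp only [TensorProduct.assoc_tmul, TensorProduct.map_tmul, LinearMap.id_apply]
          induction DeltaC p with
          | zero => simp
          | add D D' h h' => simp only [add_tmul, map_add, h, h']
          | tmul p p' => rfl
      have h2 (D : C ⊗[k] C) : TensorProduct.map LinearMap.id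
            (TensorProduct.assoc k C C X).toLinearMap (TensorProduct.assoc k C (C ⊗[k] C) X
              (TensorProduct.map LinearMap.id DeltaC D ⊗ₜ[k] x)) =
          TensorProduct.map LinearMap.id ((TensorProduct.assoc k C C X).toLinearMap ∘ₗ
            TensorProduct.map DeltaC LinearMap.id) (TensorProduct.assoc k C C X (D ⊗ₜ[k] x)) := by
        induction D with
        | zero => simp
        | add D D' h h' => simp only [add_tmul, map_add, h, h']
        | tmul p q => rfl
      have h3 : TensorProduct.assoc k C C C (TensorProduct.map DeltaC LinearMap.id (DeltaC c)) =
          TensorProduct.map LinearMap.id DeltaC (DeltaC c) := LinearMap.congr_fun hDc c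
      rw [h1, h3, h2]
    have hD (D : C ⊗[k] C) :
        TensorProduct.map LinearMap.id (TensorProduct.mk k C (C ⊗[k] X) I)
            (TensorProduct.assoc k C C X (D ⊗ₜ[k] x)) +
          TensorProduct.map LinearMap.id (dTensor DeltaC I d)
            (TensorProduct.assoc k C C X (D ⊗ₜ[k] x)) =
        TensorProduct.map LinearMap.id ((TensorProduct.assoc k C C X).toLinearMap ∘ₗ
            TensorProduct.map DeltaC LinearMap.id) (TensorProduct.assoc k C C X (D ⊗ₜ[k] x)) -
          TensorProduct.assoc k C C (C ⊗[k] X) (D ⊗ₜ[k] (I ⊗ₜ[k] x)) -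
          TensorProduct.assoc k C C (C ⊗[k] X) (D ⊗ₜ[k] d x) := by
      induction D with
      | zero => simp
      | add D D' h h' =>
        simp only [add_tmul, map_add]
        rw [add_add_add_comm, h, h']
        abel
      | tmul p q =>
        simp only [TensorProduct.assoc_tmul, TensorProduct.map_tmul, LinearMap.id_apply,
          TensorProduct.mk_apply, dTensor_tmul, tmul_sub, LinearMap.comp_apply,
          LinearEquiv.coe_coe]
        abel
    have hΔ : dTensor DeltaC I (dTensor DeltaC I d)
          (TensorProduct.assoc k C C X (DeltaC c ⊗ₜ[k] x)) =
        TensorProduct.assoc k C C (C ⊗[k] X) (DeltaC c ⊗ₜ[k] (I ⊗ₜ[k] x)) +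
          TensorProduct.assoc k C C (C ⊗[k] X) (DeltaC c ⊗ₜ[k] d x) -
          I ⊗ₜ[k] TensorProduct.assoc k C C X (DeltaC c ⊗ₜ[k] x) := by
      rw [dTensor_apply (dTensor DeltaC I d), coassoc, sub_sub, hD]
      abel
    rw [dTensor_tmul, map_sub, map_sub, map_sub, hΔ]
    simp only [dTensor_tmul, hd, hI, tmul_sub, tmul_zero, TensorProduct.assoc_tmul]
    abel

/-- The Leibniz rule passes from `X` to `C ⊗ X`. -/
lemma dTensor_tmul_mul {Y Z : Type} [AddCommGroup Y] [Module k Y] [AddCommGroup Z] [Module k Z]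
    (μ : X ⊗[k] Y →ₗ[k] Z) (d : X →ₗ[k] C ⊗[k] X) (d' : Z →ₗ[k] C ⊗[k] Z) (c : C) (x : X) (y : Y)
    (e : C ⊗[k] Z)
    (h : d' (μ (x ⊗ₜ[k] y)) =
      TensorProduct.map LinearMap.id μ (TensorProduct.assoc k C X Y (d x ⊗ₜ[k] y)) + e) :
    dTensor DeltaC I d' (c ⊗ₜ[k] μ (x ⊗ₜ[k] y)) =
      TensorProduct.map LinearMap.id
        (TensorProduct.map LinearMap.id μ ∘ₗ (TensorProduct.assoc k C X Y).toLinearMap)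
        (TensorProduct.assoc k C (C ⊗[k] X) Y (dTensor DeltaC I d (c ⊗ₜ[k] x) ⊗ₜ[k] y))
      - c ⊗ₜ[k] e := by
  have hD (D : C ⊗[k] C) : TensorProduct.assoc k C C Z (D ⊗ₜ[k] μ (x ⊗ₜ[k] y)) =
      TensorProduct.map LinearMap.id
        (TensorProduct.map LinearMap.id μ ∘ₗ (TensorProduct.assoc k C X Y).toLinearMap)
        (TensorProduct.assoc k C (C ⊗[k] X) Y (TensorProduct.assoc k C C X (D ⊗ₜ[k] x) ⊗ₜ[k] y)) := by
    induction D with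
    | zero => simp
    | add D D' h h' => simp only [add_tmul, map_add, h, h']
    | tmul p q => rfl
  simp only [dTensor_tmul, h, hD, sub_tmul, map_sub, tmul_add, TensorProduct.assoc_tmul,
    TensorProduct.map_tmul, LinearMap.comp_apply, LinearMap.id_apply, LinearEquiv.coe_coe]
  abel

lemma neg_tmul_neg_one_pow_smul (n : ℕ) (c : C) (x : X) :
    -(c ⊗ₜ[k] (((-1 : k) ^ n) • x)) = ((-1 : k) ^ (n + 1)) • (c ⊗ₜ[k] x) := by
  rw [pow_succ, mul_neg_one, neg_smul, tmul_smul]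

lemma map_rhoB (f : B ⊗[k] X →ₗ[k] X) (b : B) (x : X) :
    TensorProduct.map LinearMap.id f
        (TensorProduct.assoc k C B X (rhoB k B C l r alpha beta I b ⊗ₜ[k] x)) =
      actTensor l r alpha beta f (b ⊗ₜ[k] (I ⊗ₜ[k] x)) := by
  rw [actTensor_tmul, rhoB, LinearMap.comp_apply, LinearMap.comp_apply]
  generalize sw3 k (Delta2B k B b) = u
  induction u with
  | zero => simp
  | add u u' h h' => simp only [add_tmul, map_add, h, h']
  | tmul w s =>
  induction w with
  | zero => simp
  | add w w' h h' => simp only [add_tmul, map_add, h, h']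
  | tmul p q => rfl

/-- A product with a factor `y` commutes with the action of `B`. -/
lemma map_actTensor {Y Z : Type} [AddCommGroup Y] [Module k Y] [AddCommGroup Z] [Module k Z]
    (μ : X ⊗[k] Y →ₗ[k] Z) (f : B ⊗[k] X →ₗ[k] X) (g : B ⊗[k] Z →ₗ[k] Z) (y : Y)
    (h : ∀ (b : B) (x : X), μ (f (b ⊗ₜ[k] x) ⊗ₜ[k] y) = g (b ⊗ₜ[k] μ (x ⊗ₜ[k] y)))
    (b : B) (x : C ⊗[k] X) :
    TensorProduct.map LinearMap.id μ (TensorProduct.assoc k C X Y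
        (actTensor l r alpha beta f (b ⊗ₜ[k] x) ⊗ₜ[k] y)) =
      actTensor l r alpha beta g (b ⊗ₜ[k]
        TensorProduct.map LinearMap.id μ (TensorProduct.assoc k C X Y (x ⊗ₜ[k] y))) := by
  rw [actTensor_tmul, actTensor_tmul]
  generalize sw3 k (Delta2B k B b) = u
  induction x with
  | zero => simp
  | add x x' h h' => simp only [add_tmul, tmul_add, map_add, h, h']
  | tmul c x =>
  induction u with
  | zero => simp
  | add u u' h h' => simp only [add_tmul, map_add, h, h']
  | tmul w s =>
    simp only [legAct_tmul, TensorProduct.assoc_tmul, TensorProduct.map_tmul, h,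
      LinearMap.id_apply]

end Abstract

lemma rhoB_eq (b : B) :
    rhoB k B C l r alpha beta I b =
      actTensor l r alpha beta (LinearMap.mul' k B) (b ⊗ₜ[k] (I ⊗ₜ[k] 1)) := by
  rw [← map_rhoB]
  induction rhoB k B C l r alpha beta I b with
  | zero => simp
  | add u u' h h' =>
    simp only [add_tmul, map_add]
    rw [← h, ← h']
  | tmul c b => simp

lemma rhoB_one (hl1 : l 1 = LinearMap.id) (hr1 : r 1 = LinearMap.id) (ha1 : alpha 1 = 1)
    (hb1 : beta 1 = 1) : rhoB k B C l r alpha beta I 1 = I ⊗ₜ[k] 1 := by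
  rw [rhoB, LinearMap.comp_apply, LinearMap.comp_apply, Delta2B_one,
    Algebra.TensorProduct.one_def, Algebra.TensorProduct.one_def, sw3_tmul,
    TensorProduct.map_tmul, xiB_tmul, legB_tmul, ha1, hb1, hl1, hr1]
  rfl

variable (k B C DeltaC l r alpha beta I) in
/-- The differential with its codomain written as a tensor product. -/
def dUnroll (n : ℕ) : KB k B C n →ₗ[k] C ⊗[k] KB k B C n :=
  unrollB k B C n ∘ₗ dB k B C DeltaC l r alpha beta I n

lemma KB_induction {n : ℕ} {p : KB k B C (n + 1) → Prop} (zero : p 0)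
    (tmul : ∀ (c : C) (x : KB k B C n), p (show KB k B C (n + 1) from c ⊗ₜ[k] x))
    (add : ∀ x y : KB k B C (n + 1), p x → p y → p (x + y)) (x : KB k B C (n + 1)) : p x :=
  TensorProduct.induction_on (motive := p) x zero tmul add

lemma dcastB_tmul {a b : ℕ} (h : a = b) (h' : a + 1 = b + 1) (c : C) (x : KB k B C a) :
    unrollB k B C b (dcastB k B C h' (show KB k B C (a + 1) from c ⊗ₜ[k] x)) =
      c ⊗ₜ[k] dcastB k B C h x := by
  subst h
  rfl

lemma lactB_mul
    (hlm : ∀ a b : B, l (a * b) = l a ∘ₗ l b) (hrm : ∀ a b : B, r (a * b) = r b ∘ₗ r a)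
    (hlr : ∀ a b : B, l a ∘ₗ r b = r b ∘ₗ l a)
    (ham : ∀ a b : B, alpha (a * b) = alpha a * alpha b)
    (hbm : ∀ a b : B, beta (a * b) = beta b * beta a) (n : ℕ) (a b : B) (y : KB k B C n) :
    lactB k B C l r alpha beta n ((a * b) ⊗ₜ[k] y) =
      lactB k B C l r alpha beta n (a ⊗ₜ[k] lactB k B C l r alpha beta n (b ⊗ₜ[k] y)) := by
  induction n generalizing a b with
  | zero => exact mul_assoc a b y
  | succ n ih => exact actTensor_mul hlm hrm hlr ham hbm _ ih a b y

/-- The Leibniz rule for `b · y` with `b` of degree zero. -/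
lemma dUnroll_lactB
    (hlm : ∀ a b : B, l (a * b) = l a ∘ₗ l b) (hrm : ∀ a b : B, r (a * b) = r b ∘ₗ r a)
    (hlr : ∀ a b : B, l a ∘ₗ r b = r b ∘ₗ l a)
    (hbimL : DeltaC ∘ₗ TensorProduct.lift l =
        (TensorProduct.map (TensorProduct.lift l) (TensorProduct.lift l))
          ∘ₗ (TensorProduct.tensorTensorTensorComm k B B C C).toLinearMap
          ∘ₗ (TensorProduct.map Coalgebra.comul DeltaC))
    (hbimR : DeltaC ∘ₗ TensorProduct.lift r =
        (TensorProduct.map (TensorProduct.lift r) (TensorProduct.lift r))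
          ∘ₗ (TensorProduct.tensorTensorTensorComm k B B C C).toLinearMap
          ∘ₗ (TensorProduct.map Coalgebra.comul DeltaC))
    (ham : ∀ a b : B, alpha (a * b) = alpha a * alpha b)
    (hac : Coalgebra.comul ∘ₗ alpha = (TensorProduct.map alpha alpha) ∘ₗ Coalgebra.comul)
    (hbm : ∀ a b : B, beta (a * b) = beta b * beta a)
    (hbc : Coalgebra.comul ∘ₗ beta =
        (TensorProduct.comm k B B).toLinearMap
          ∘ₗ (TensorProduct.map beta beta) ∘ₗ Coalgebra.comul)
    (n : ℕ) (b : B) (y : KB k B C n) :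
    dUnroll k B C DeltaC l r alpha beta I n (lactB k B C l r alpha beta n (b ⊗ₜ[k] y)) =
      actTensor l r alpha beta (lactB k B C l r alpha beta n) (b ⊗ₜ[k] (I ⊗ₜ[k] y))
        - I ⊗ₜ[k] lactB k B C l r alpha beta n (b ⊗ₜ[k] y)
        + actTensor l r alpha beta (lactB k B C l r alpha beta n)
            (b ⊗ₜ[k] dUnroll k B C DeltaC l r alpha beta I n y) := by
  induction n generalizing b with
  | zero =>
    have h (y : B) : rhoB k B C l r alpha beta I (b * y) - I ⊗ₜ[k] (b * y) =
        actTensor l r alpha beta (LinearMap.mul' k B) (b ⊗ₜ[k] (I ⊗ₜ[k] y)) - I ⊗ₜ[k] (b * y) +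
        actTensor l r alpha beta (LinearMap.mul' k B)
          (b ⊗ₜ[k] (rhoB k B C l r alpha beta I y - I ⊗ₜ[k] y)) := by
      rw [rhoB_eq, rhoB_eq, actTensor_mul hlm hrm hlr ham hbm _
        (fun a b x => by simp [mul_assoc]), tmul_sub, map_sub]
      abel
    exact h y
  | succ n ih => exact dTensor_actTensor hbimL hbimR hac hbc _ _ ih b y

lemma muB_lactB
    (hlm : ∀ a b : B, l (a * b) = l a ∘ₗ l b) (hrm : ∀ a b : B, r (a * b) = r b ∘ₗ r a)
    (hlr : ∀ a b : B, l a ∘ₗ r b = r b ∘ₗ l a)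
    (ham : ∀ a b : B, alpha (a * b) = alpha a * alpha b)
    (hbm : ∀ a b : B, beta (a * b) = beta b * beta a)
    (m j : ℕ) (b : B) (y : KB k B C m) (z : KB k B C j) :
    muB k B C l r alpha beta m j (lactB k B C l r alpha beta m (b ⊗ₜ[k] y) ⊗ₜ[k] z) =
      lactB k B C l r alpha beta (j + m)
        (b ⊗ₜ[k] muB k B C l r alpha beta m j (y ⊗ₜ[k] z)) := by
  induction m generalizing b with
  | zero => exact lactB_mul hlm hrm hlr ham hbm j b y z
  | succ m ih => exact map_actTensor _ _ _ z ih b y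

lemma muB_assoc
    (hlm : ∀ a b : B, l (a * b) = l a ∘ₗ l b) (hrm : ∀ a b : B, r (a * b) = r b ∘ₗ r a)
    (hlr : ∀ a b : B, l a ∘ₗ r b = r b ∘ₗ l a)
    (ham : ∀ a b : B, alpha (a * b) = alpha a * alpha b)
    (hbm : ∀ a b : B, beta (a * b) = beta b * beta a)
    (n m j : ℕ) (Ψ : KB k B C n) (Φ : KB k B C m) (Ξ : KB k B C j) :
    muB k B C l r alpha beta (m + n) j
        ((muB k B C l r alpha beta n m (Ψ ⊗ₜ[k] Φ)) ⊗ₜ[k] Ξ) =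
      dcastB k B C (Nat.add_assoc j m n)
        (muB k B C l r alpha beta n (j + m)
          (Ψ ⊗ₜ[k] muB k B C l r alpha beta m j (Φ ⊗ₜ[k] Ξ))) := by
  induction n with
  | zero => exact muB_lactB hlm hrm hlr ham hbm m j Ψ Φ Ξ
  | succ n ih =>
    induction Ψ using KB_induction with
    | zero => simp
    | add x y hx hy => simp only [add_tmul, map_add, hx, hy]
    | tmul c x =>
      refine Eq.trans ?_ (dcastB_tmul (Nat.add_assoc j m n) (Nat.add_assoc j m (n + 1)) c
        (muB k B C l r alpha beta n (j + m)
          (x ⊗ₜ[k] muB k B C l r alpha beta m j (Φ ⊗ₜ[k] Ξ)))).symm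
      rw [← ih x]
      rfl

lemma dUnroll_muB
    (hlm : ∀ a b : B, l (a * b) = l a ∘ₗ l b) (hrm : ∀ a b : B, r (a * b) = r b ∘ₗ r a)
    (hlr : ∀ a b : B, l a ∘ₗ r b = r b ∘ₗ l a)
    (hbimL : DeltaC ∘ₗ TensorProduct.lift l =
        (TensorProduct.map (TensorProduct.lift l) (TensorProduct.lift l))
          ∘ₗ (TensorProduct.tensorTensorTensorComm k B B C C).toLinearMap
          ∘ₗ (TensorProduct.map Coalgebra.comul DeltaC))
    (hbimR : DeltaC ∘ₗ TensorProduct.lift r =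
        (TensorProduct.map (TensorProduct.lift r) (TensorProduct.lift r))
          ∘ₗ (TensorProduct.tensorTensorTensorComm k B B C C).toLinearMap
          ∘ₗ (TensorProduct.map Coalgebra.comul DeltaC))
    (ham : ∀ a b : B, alpha (a * b) = alpha a * alpha b)
    (hac : Coalgebra.comul ∘ₗ alpha = (TensorProduct.map alpha alpha) ∘ₗ Coalgebra.comul)
    (hbm : ∀ a b : B, beta (a * b) = beta b * beta a)
    (hbc : Coalgebra.comul ∘ₗ beta =
        (TensorProduct.comm k B B).toLinearMap
          ∘ₗ (TensorProduct.map beta beta) ∘ₗ Coalgebra.comul)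
    (n m : ℕ) (Ψ : KB k B C n) (Φ : KB k B C m) :
    dUnroll k B C DeltaC l r alpha beta I (m + n)
        (muB k B C l r alpha beta n m (Ψ ⊗ₜ[k] Φ)) =
      TensorProduct.map LinearMap.id (muB k B C l r alpha beta n m)
        (TensorProduct.assoc k C (KB k B C n) (KB k B C m)
          (dUnroll k B C DeltaC l r alpha beta I n Ψ ⊗ₜ[k] Φ)) +
      ((-1 : k) ^ n) • unrollB k B C (m + n) (dcastB k B C (Nat.add_right_comm m 1 n)
        (muB k B C l r alpha beta n (m + 1)
          (Ψ ⊗ₜ[k] dB k B C DeltaC l r alpha beta I m Φ))) := by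
  induction n with
  | zero =>
    have h (b : B) : dUnroll k B C DeltaC l r alpha beta I m
          (lactB k B C l r alpha beta m (b ⊗ₜ[k] Φ)) =
        TensorProduct.map LinearMap.id (lactB k B C l r alpha beta m)
          (TensorProduct.assoc k C B (KB k B C m)
            ((rhoB k B C l r alpha beta I b - I ⊗ₜ[k] b) ⊗ₜ[k] Φ)) +
        ((-1 : k) ^ 0) • actTensor l r alpha beta (lactB k B C l r alpha beta m)
            (b ⊗ₜ[k] dUnroll k B C DeltaC l r alpha beta I m Φ) := by
      rw [dUnroll_lactB hlm hrm hlr hbimL hbimR ham hac hbm hbc, sub_tmul, map_sub, map_sub,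
        map_rhoB, pow_zero, one_smul]
      rfl
    exact h Ψ
  | succ n ih =>
    induction Ψ using KB_induction with
    | zero => simp
    | add x y hx hy =>
      simp only [add_tmul, map_add, smul_add, hx, hy]
      abel
    | tmul c x =>
      refine (dTensor_tmul_mul _ _ _ c x Φ _ (ih x)).trans ?_
      rw [sub_eq_add_neg]
      congr 1
      refine Eq.trans ?_ (congrArg (fun z => ((-1 : k) ^ (n + 1)) • z)
        (dcastB_tmul (Nat.add_right_comm m 1 n) (Nat.add_right_comm m 1 (n + 1)) c
        (muB k B C l r alpha beta n (m + 1)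
          (x ⊗ₜ[k] dB k B C DeltaC l r alpha beta I m Φ))).symm)
      exact neg_tmul_neg_one_pow_smul n c _

lemma dTensor_dUnroll
    (hDc : (TensorProduct.assoc k C C C).toLinearMap ∘ₗ
        (TensorProduct.map DeltaC LinearMap.id) ∘ₗ DeltaC =
        (TensorProduct.map LinearMap.id DeltaC) ∘ₗ DeltaC)
    (hl1 : l 1 = LinearMap.id) (hr1 : r 1 = LinearMap.id)
    (hlm : ∀ a b : B, l (a * b) = l a ∘ₗ l b) (hrm : ∀ a b : B, r (a * b) = r b ∘ₗ r a)
    (hlr : ∀ a b : B, l a ∘ₗ r b = r b ∘ₗ l a)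
    (hbimL : DeltaC ∘ₗ TensorProduct.lift l =
        (TensorProduct.map (TensorProduct.lift l) (TensorProduct.lift l))
          ∘ₗ (TensorProduct.tensorTensorTensorComm k B B C C).toLinearMap
          ∘ₗ (TensorProduct.map Coalgebra.comul DeltaC))
    (hbimR : DeltaC ∘ₗ TensorProduct.lift r =
        (TensorProduct.map (TensorProduct.lift r) (TensorProduct.lift r))
          ∘ₗ (TensorProduct.tensorTensorTensorComm k B B C C).toLinearMap
          ∘ₗ (TensorProduct.map Coalgebra.comul DeltaC))
    (hI : DeltaC I = I ⊗ₜ[k] I) (ha1 : alpha 1 = 1)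
    (ham : ∀ a b : B, alpha (a * b) = alpha a * alpha b)
    (hac : Coalgebra.comul ∘ₗ alpha = (TensorProduct.map alpha alpha) ∘ₗ Coalgebra.comul)
    (hb1 : beta 1 = 1) (hbm : ∀ a b : B, beta (a * b) = beta b * beta a)
    (hbc : Coalgebra.comul ∘ₗ beta =
        (TensorProduct.comm k B B).toLinearMap
          ∘ₗ (TensorProduct.map beta beta) ∘ₗ Coalgebra.comul)
    (n : ℕ) (y : KB k B C n) :
    dTensor DeltaC I (dUnroll k B C DeltaC l r alpha beta I n)
      (dUnroll k B C DeltaC l r alpha beta I n y) = 0 := by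
  induction n with
  | zero =>
    have h (d : B →ₗ[k] C ⊗[k] B)
        (hd : ∀ b, d b = rhoB k B C l r alpha beta I b - I ⊗ₜ[k] b)
        (hLeib : ∀ b x : B, d (LinearMap.mul' k B (b ⊗ₜ[k] x)) =
          actTensor l r alpha beta (LinearMap.mul' k B) (b ⊗ₜ[k] (I ⊗ₜ[k] x))
            - I ⊗ₜ[k] LinearMap.mul' k B (b ⊗ₜ[k] x)
            + actTensor l r alpha beta (LinearMap.mul' k B) (b ⊗ₜ[k] d x)) (b : B) :
        dTensor DeltaC I d (d b) = 0 := by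
      have h1 : d 1 = 0 := by rw [hd, rhoB_one hl1 hr1 ha1 hb1, sub_self]
      have hI1 : dTensor DeltaC I d (I ⊗ₜ[k] 1) = -(I ⊗ₜ[k] (I ⊗ₜ[k] 1)) := by
        rw [dTensor_tmul, hI, h1, TensorProduct.assoc_tmul, tmul_zero]
        abel
      have hρ : dTensor DeltaC I d (rhoB k B C l r alpha beta I b) =
          - (I ⊗ₜ[k] rhoB k B C l r alpha beta I b) := by
        rw [rhoB_eq, dTensor_actTensor hbimL hbimR hac hbc _ _ hLeib, hI1, tmul_neg,
          map_neg]
        abel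
      rw [hd, map_sub, hρ, dTensor_tmul, hI, TensorProduct.assoc_tmul, hd, tmul_sub]
      abel
    exact h (dUnroll k B C DeltaC l r alpha beta I 0) (fun _ => rfl)
      (dUnroll_lactB hlm hrm hlr hbimL hbimR ham hac hbm hbc 0) y
  | succ n ih => exact dTensor_dTensor hDc hI _ ih y

end Helpers

theorem statement17
    -- `C` is a coalgebra:
    (epsC : C →ₗ[k] k)
    (hDc : (TensorProduct.assoc k C C C).toLinearMap ∘ₗ
        (TensorProduct.map DeltaC LinearMap.id) ∘ₗ DeltaC =
        (TensorProduct.map LinearMap.id DeltaC) ∘ₗ DeltaC)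
    (hCe1 : (TensorProduct.lid k C).toLinearMap ∘ₗ
        (TensorProduct.map epsC LinearMap.id) ∘ₗ DeltaC = LinearMap.id)
    (hCe2 : (TensorProduct.rid k C).toLinearMap ∘ₗ
        (TensorProduct.map LinearMap.id epsC) ∘ₗ DeltaC = LinearMap.id)
    -- `C` is a `B`-bimodule:
    (hl1 : l 1 = LinearMap.id) (hlm : ∀ a b : B, l (a * b) = l a ∘ₗ l b)
    (hr1 : r 1 = LinearMap.id) (hrm : ∀ a b : B, r (a * b) = r b ∘ₗ r a)
    (hlr : ∀ a b : B, l a ∘ₗ r b = r b ∘ₗ l a)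
    -- `Δ_C` is a morphism of `B`-bimodules (diagonal actions):
    (hbimL : DeltaC ∘ₗ TensorProduct.lift l =
        (TensorProduct.map (TensorProduct.lift l) (TensorProduct.lift l))
          ∘ₗ (TensorProduct.tensorTensorTensorComm k B B C C).toLinearMap
          ∘ₗ (TensorProduct.map Coalgebra.comul DeltaC))
    (hbimR : DeltaC ∘ₗ TensorProduct.lift r =
        (TensorProduct.map (TensorProduct.lift r) (TensorProduct.lift r))
          ∘ₗ (TensorProduct.tensorTensorTensorComm k B B C C).toLinearMap
          ∘ₗ (TensorProduct.map Coalgebra.comul DeltaC))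
    -- `𝕀` is a grouplike element of `C`:
    (hI : DeltaC I = I ⊗ₜ[k] I)
    -- `α : B → B` is a morphism of bialgebras:
    (ha1 : alpha 1 = 1) (ham : ∀ a b : B, alpha (a * b) = alpha a * alpha b)
    (hac : Coalgebra.comul ∘ₗ alpha = (TensorProduct.map alpha alpha) ∘ₗ Coalgebra.comul)
    (hae : Coalgebra.counit ∘ₗ alpha = (Coalgebra.counit : B →ₗ[k] k))
    -- `β : B → B^{op,cop}` is a morphism of bialgebras:
    (hb1 : beta 1 = 1) (hbm : ∀ a b : B, beta (a * b) = beta b * beta a)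
    (hbc : Coalgebra.comul ∘ₗ beta =
        (TensorProduct.comm k B B).toLinearMap
          ∘ₗ (TensorProduct.map beta beta) ∘ₗ Coalgebra.comul)
    (hbe : Coalgebra.counit ∘ₗ beta = (Coalgebra.counit : B →ₗ[k] k))
    :
    -- the product is associative:
    (∀ (n m j : ℕ) (Ψ : KB k B C n) (Φ : KB k B C m) (Ξ : KB k B C j),
      muB k B C l r alpha beta (m + n) j
          ((muB k B C l r alpha beta n m (Ψ ⊗ₜ[k] Φ)) ⊗ₜ[k] Ξ) =
        dcastB k B C (Nat.add_assoc j m n)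
          (muB k B C l r alpha beta n (j + m)
            (Ψ ⊗ₜ[k] muB k B C l r alpha beta m j (Φ ⊗ₜ[k] Ξ)))) ∧
    -- the graded Leibniz rule:
    (∀ (n m : ℕ) (Ψ : KB k B C n) (Φ : KB k B C m),
      dB k B C DeltaC l r alpha beta I (m + n)
          (muB k B C l r alpha beta n m (Ψ ⊗ₜ[k] Φ)) =
        dcastB k B C (Nat.add_succ m n)
          (muB k B C l r alpha beta (n + 1) m
            ((dB k B C DeltaC l r alpha beta I n Ψ) ⊗ₜ[k] Φ))
        + ((-1 : k) ^ n) •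
            dcastB k B C (Nat.add_right_comm m 1 n)
              (muB k B C l r alpha beta n (m + 1)
                (Ψ ⊗ₜ[k] dB k B C DeltaC l r alpha beta I m Φ))) ∧
    -- `d² = 0`:
    (∀ n : ℕ, (dB k B C DeltaC l r alpha beta I (n + 1)) ∘ₗ
        (dB k B C DeltaC l r alpha beta I n) = 0) := by
  refine ⟨muB_assoc hlm hrm hlr ham hbm, fun n m Ψ Φ => ?_, fun n => ?_⟩
  · exact dUnroll_muB hlm hrm hlr hbimL hbimR ham hac hbm hbc n m Ψ Φ
  · ext y
    exact dTensor_dUnroll hDc hl1 hr1 hlm hrm hlr hbimL hbimR hI ha1 ham hac hb1 hbm hbc n y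

end
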